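/- Let R = k[T₁,…,T_d] be a polynomial ring over a field k and let α be a maximal ideal of R with simple module S_α = R/m_α. Then Ext^d_R(S_α, S_α) is one-dimensional over End(S_α), generated by the class of an exact sequence 0 → S_α → M₁ → ⋯ → M_d → S_α → 0 in which each M_i is an indecomposable R_α-module of length 2. -/

import Mathlib

open CategoryTheory

universe u

/-- An indecomposable module: nonzero, and the only idempotent endomorphisms are 0 and 1. -/
def Indec (Λ : Type u) [Ring Λ] (N : Type u) [AddCommGroup N] [Module Λ N] : Prop :=
  Nontrivial N ∧ ∀ e : Module.End Λ N, e * e = e → e = 0 ∨ e = 1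

/-- Splicing a chain of degree-one extension classes into a single Yoneda extension class. -/
noncomputable def chainExt {C : Type (u+1)} [Category.{u} C] [Abelian C]
    [CategoryTheory.HasExt.{u} C]
    (K : ℕ → C) (ξ : ∀ i, Abelian.Ext (K i) (K (i+1)) 1) :
    ∀ i, Abelian.Ext (K 0) (K i) i
  | 0 => Abelian.Ext.mk₀ (𝟙 _)
  | (i+1) => (chainExt K ξ i).comp (ξ i) rfl

/-- The ideal generated by the entries `f i, …, f (d - 1)`. -/
def tailIdeal {R : Type*} [CommRing R] (f : ℕ → R) (d i : ℕ) : Ideal R :=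
  Ideal.span (f '' Set.Ico i d)

/-- `f (d - 1), …, f 0` is a weakly regular sequence: each `f i` is a non-zero-divisor modulo
the entries of larger index. -/
def IsTailRegular {R : Type*} [CommRing R] (f : ℕ → R) (d : ℕ) : Prop :=
  ∀ i < d, ∀ x, f i * x ∈ tailIdeal f d (i + 1) → x ∈ tailIdeal f d (i + 1)

section TailIdeal

variable {R : Type*} [CommRing R] {f : ℕ → R} {d : ℕ}

lemma tailIdeal_self : tailIdeal f d d = ⊥ := by simp [tailIdeal]

lemma mem_tailIdeal {i j : ℕ} (hij : i ≤ j) (hj : j < d) : f j ∈ tailIdeal f d i :=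
  Ideal.subset_span ⟨j, ⟨hij, hj⟩, rfl⟩

lemma tailIdeal_anti {i j : ℕ} (hij : i ≤ j) : tailIdeal f d j ≤ tailIdeal f d i :=
  Ideal.span_mono (Set.image_mono (Set.Ico_subset_Ico_left hij))

lemma tailIdeal_eq_sup {i : ℕ} (hi : i < d) :
    tailIdeal f d i = Ideal.span {f i} ⊔ tailIdeal f d (i + 1) := by
  rw [tailIdeal, ← Set.insert_Ico_add_one_left_eq_Ico hi, Set.image_insert_eq, Ideal.span_insert,
    tailIdeal]

lemma mem_tailIdeal_iff {i : ℕ} {x : R} :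
    x ∈ tailIdeal f d i ↔ ∃ a : ℕ → R, ∑ j ∈ Finset.Ico i d, a j * f j = x := by
  rw [tailIdeal, ← Finset.coe_Ico, Ideal.span, Submodule.mem_span_image_finset_iff_exists_fun']
  rfl

/-- The coefficients of a relation among the entries of a regular sequence lie in the ideal
generated by the sequence. -/
lemma IsTailRegular.coeff_mem (hf : IsTailRegular f d) {i : ℕ} (hi : i ≤ d) :
    ∀ b : ℕ → R, ∑ j ∈ Finset.Ico i d, b j * f j = 0 →
      ∀ j ∈ Finset.Ico i d, b j ∈ tailIdeal f d i := by
  induction hi using Nat.decreasingInduction with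
  | self => simp
  | of_succ i hi ih =>
    intro b hb
    rw [Finset.sum_eq_sum_Ico_succ_bot hi] at hb
    have hbi : b i ∈ tailIdeal f d (i + 1) := by
      refine hf i hi _ ?_
      rw [mul_comm, eq_neg_of_add_eq_zero_left hb]
      exact neg_mem (mem_tailIdeal_iff.2 ⟨b, rfl⟩)
    obtain ⟨c, hc⟩ := mem_tailIdeal_iff.1 hbi
    have key := ih (fun j => b j + f i * c j) (by
      rw [← hb, ← hc, Finset.sum_mul, add_comm, ← Finset.sum_add_distrib]
      exact Finset.sum_congr rfl fun j _ => by ring)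
    intro j hj
    rcases (Finset.mem_Ico.1 hj).1.eq_or_lt with rfl | hij
    · exact tailIdeal_anti (Nat.le_succ _) hbi
    · have h1 := tailIdeal_anti (Nat.le_succ i)
        (key j (Finset.mem_Ico.2 ⟨hij, (Finset.mem_Ico.1 hj).2⟩))
      have h2 : f i * c j ∈ tailIdeal f d i := Ideal.mul_mem_right _ _ (mem_tailIdeal le_rfl hi)
      simpa using sub_mem h1 h2

/-- The ideal `I² + (f j : j ≠ i)`, where `I` is generated by `f 0, …, f (d - 1)`. -/
def omitIdeal (f : ℕ → R) (d i : ℕ) : Ideal R :=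
  tailIdeal f d 0 ^ 2 ⊔ Ideal.span (f '' {j | j < d ∧ j ≠ i})

lemma mem_sq_tailIdeal {x : R} (hx : x ∈ tailIdeal f d 0 ^ 2) :
    ∃ a : ℕ → R, (∀ j, a j ∈ tailIdeal f d 0) ∧ ∑ j ∈ Finset.Ico 0 d, a j * f j = x := by
  rw [pow_two] at hx
  induction hx using Submodule.mul_induction_on' with
  | mem_mul_mem y hy z hz =>
    obtain ⟨a, rfl⟩ := mem_tailIdeal_iff.1 hz
    exact ⟨fun j => y * a j, fun j => Ideal.mul_mem_right _ _ hy, by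
      simp only [Finset.mul_sum, mul_assoc]⟩
  | add y _ z _ hy hz =>
    obtain ⟨a, ha, rfl⟩ := hy
    obtain ⟨b, hb, rfl⟩ := hz
    exact ⟨fun j => a j + b j, fun j => add_mem (ha j) (hb j), by
      simp only [add_mul, Finset.sum_add_distrib]⟩

/-- A regular sequence generating a proper ideal generates it minimally. -/
lemma IsTailRegular.notMem_omitIdeal (hf : IsTailRegular f d) (h1 : tailIdeal f d 0 ≠ ⊤)
    {i : ℕ} (hi : i < d) : f i ∉ omitIdeal f d i := by
  intro h
  obtain ⟨y, hy, z, hz, hyz⟩ := Submodule.mem_sup.1 h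
  obtain ⟨a, ha, rfl⟩ := mem_sq_tailIdeal hy
  have hset : {j | j < d ∧ j ≠ i} = (((Finset.Ico 0 d).erase i : Finset ℕ) : Set ℕ) := by
    ext j; simp [and_comm]
  rw [hset, Ideal.span, Submodule.mem_span_image_finset_iff_exists_fun'] at hz
  obtain ⟨b, rfl⟩ := hz
  have hmem : i ∈ Finset.Ico 0 d := by simpa using hi
  have := hf.coeff_mem (Nat.zero_le d) (fun j => a j + if j = i then -1 else b j) (by
    rw [← Finset.add_sum_erase _ _ hmem] at hyz ⊢
    rw [Finset.sum_congr rfl (g := fun j => a j * f j + b j * f j)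
      (fun j hj => by simp [Finset.ne_of_mem_erase hj, add_mul]), Finset.sum_add_distrib]
    simp only [if_true, smul_eq_mul] at hyz ⊢
    linear_combination hyz) i hmem
  simp only [if_true] at this
  refine h1 ((Ideal.eq_top_iff_one _).2 ?_)
  simpa using sub_mem (ha i) this

lemma omitIdeal_le {i : ℕ} : omitIdeal f d i ≤ tailIdeal f d 0 := by
  refine sup_le (Ideal.pow_le_self two_ne_zero) (Ideal.span_mono (Set.image_mono ?_))
  exact fun j hj => ⟨Nat.zero_le j, hj.1⟩

lemma tailIdeal_le_sup_omitIdeal {i : ℕ} :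
    tailIdeal f d 0 ≤ Ideal.span {f i} ⊔ omitIdeal f d i := by
  refine Ideal.span_le.2 ?_
  rintro _ ⟨j, hj, rfl⟩
  by_cases hji : j = i
  · subst hji
    exact Ideal.mem_sup_left (Ideal.mem_span_singleton_self _)
  · exact Ideal.mem_sup_right (Ideal.mem_sup_right (Ideal.subset_span ⟨j, ⟨hj.2, hji⟩, rfl⟩))

lemma tailIdeal_succ_le_omitIdeal {i : ℕ} : tailIdeal f d (i + 1) ≤ omitIdeal f d i := by
  refine le_trans (Ideal.span_mono (Set.image_mono ?_)) le_sup_right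
  exact fun j hj => ⟨hj.2, (Nat.lt_of_succ_le hj.1).ne'⟩

end TailIdeal

/-- Every maximal ideal of `R` is generated by a regular sequence of length `d`. -/
def MaximalIdealsRegular (R : Type*) [CommRing R] (d : ℕ) : Prop :=
  ∀ m : Ideal R, m.IsMaximal → ∃ f : ℕ → R, IsTailRegular f d ∧ tailIdeal f d 0 = m

lemma tailIdeal_map {R S : Type*} [CommRing R] [CommRing S] (φ : R →+* S) (f : ℕ → R) (d i : ℕ) :
    (tailIdeal f d i).map φ = tailIdeal (φ ∘ f) d i := by
  rw [tailIdeal, Ideal.map_span, tailIdeal, Set.image_comp]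

lemma MaximalIdealsRegular.of_ringEquiv {R S : Type*} [CommRing R] [CommRing S] {d : ℕ}
    (h : MaximalIdealsRegular R d) (e : R ≃+* S) : MaximalIdealsRegular S d := by
  intro m hm
  obtain ⟨f, hf, hfm⟩ := h (m.comap (e : R →+* S))
    (Ideal.comap_isMaximal_of_surjective _ e.surjective)
  have hmem (i : ℕ) (x : S) :
      x ∈ tailIdeal ((e : R →+* S) ∘ f) d i ↔ e.symm x ∈ tailIdeal f d i := by
    rw [← tailIdeal_map]
    constructor
    · intro hx
      obtain ⟨y, hy, rfl⟩ := (Ideal.mem_map_iff_of_surjective _ e.surjective).1 hx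
      simpa using hy
    · intro hx
      simpa using Ideal.mem_map_of_mem (e : R →+* S) hx
  refine ⟨(e : R →+* S) ∘ f, fun i hi x hx => ?_, ?_⟩
  · rw [hmem] at hx ⊢
    exact hf i hi _ (by simpa using hx)
  · ext x
    rw [hmem, hfm, Ideal.mem_comap]
    simp

lemma MaximalIdealsRegular.of_field (k : Type*) [Field k] : MaximalIdealsRegular k 0 := by
  intro m hm
  refine ⟨0, fun i hi => absurd hi (Nat.not_lt_zero i), ?_⟩
  rw [tailIdeal_self, Ideal.eq_bot_of_prime m]

open Polynomial in
lemma MaximalIdealsRegular.polynomial {R : Type*} [CommRing R] [IsJacobsonRing R] {d : ℕ}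
    (h : MaximalIdealsRegular R d) : MaximalIdealsRegular R[X] (d + 1) := by
  intro M hM
  have hm : (M.comap (C : R →+* R[X])).IsMaximal := isMaximal_comap_C_of_isJacobsonRing M
  set m := M.comap (C : R →+* R[X])
  obtain ⟨f, hf, hfm⟩ := h m hm
  let := Ideal.Quotient.field m
  let φ : R[X] →+* (R ⧸ m)[X] := mapRingHom (Ideal.Quotient.mk m)
  have hφ : Function.Surjective φ := map_surjective _ Ideal.Quotient.mk_surjective
  have hker : RingHom.ker φ = m.map C := by
    rw [ker_mapRingHom, Ideal.mk_ker]
  have hkerM : m.map C ≤ M := Ideal.map_comap_le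
  obtain ⟨p, hp⟩ := IsPrincipalIdealRing.principal (M.map φ)
  obtain ⟨g, rfl⟩ := hφ p
  have hM' : M = Ideal.span {g} ⊔ m.map C := by
    rw [← hker, ← Ideal.comap_map_of_surjective' φ hφ, Ideal.map_span, Set.image_singleton,
      Ideal.span, ← hp, Ideal.comap_map_of_surjective' φ hφ, hker, sup_eq_left.2 hkerM]
  have hg : φ g ≠ 0 := by
    intro h0
    have hgm : g ∈ m.map C := hker ▸ h0
    have hMm : M = m.map C := by
      rw [hM', sup_eq_right, Ideal.span_singleton_le_iff_mem]
      exact hgm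
    have : X ∉ m.map (C : R →+* R[X]) := fun hX => hm.ne_top <|
      (Ideal.eq_top_iff_one _).2 (by simpa using Ideal.mem_map_C_iff.1 hX 1)
    rw [← hMm] at this
    obtain ⟨y, i, hi, hyi⟩ := hM.exists_inv this
    rw [hMm] at hi
    have := Ideal.mem_map_C_iff.1 hi 0
    have h1 := congrArg (fun q => q.coeff 0) hyi
    simp only [coeff_add, mul_coeff_zero, coeff_X_zero, mul_zero, zero_add, coeff_one_zero] at h1
    exact hm.ne_top ((Ideal.eq_top_iff_one _).2 (h1 ▸ this))
  let F : ℕ → R[X] := fun n => n.casesOn g (fun j => C (f j))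
  have hF (i : ℕ) : tailIdeal F (d + 1) (i + 1) = (tailIdeal f d i).map C := by
    rw [tailIdeal_map, tailIdeal, tailIdeal, ← Set.image_add_const_Ico, Set.image_image]
    rfl
  refine ⟨F, ?_, ?_⟩
  · rintro (_ | i) hi x hx
    · rw [hF, hfm, ← hker, RingHom.mem_ker] at hx ⊢
      rw [map_mul] at hx
      exact (mul_eq_zero.1 hx).resolve_left hg
    · rw [hF, Ideal.mem_map_C_iff] at hx ⊢
      exact fun n => hf i (Nat.lt_of_succ_lt_succ hi) _ (by simpa [F, coeff_C_mul] using hx n)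
  · rw [tailIdeal_eq_sup (Nat.succ_pos d), hF, hfm]
    exact hM'.symm

lemma maximalIdealsRegular_mvPolynomial (k : Type*) [Field k] (d : ℕ) :
    MaximalIdealsRegular (MvPolynomial (Fin d) k) d := by
  induction d with
  | zero =>
    exact (MaximalIdealsRegular.of_field k).of_ringEquiv
      (MvPolynomial.isEmptyRingEquiv k (Fin 0)).symm
  | succ d ih =>
    exact ih.polynomial.of_ringEquiv
      (MvPolynomial.finSuccEquiv k d).toRingEquiv.symm

section ChainExt

variable {C : Type (u + 1)} [Category.{u} C] [Abelian C] [HasExt.{u} C]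

open Abelian

lemma chainExt_comp_mk₀ {K L : ℕ → C} (ξ : ∀ i, Ext (K i) (K (i + 1)) 1)
    (η : ∀ i, Ext (L i) (L (i + 1)) 1) (π : ∀ i, K i ⟶ L i) (n : ℕ)
    (h : ∀ i < n, (ξ i).comp (Ext.mk₀ (π (i + 1))) (add_zero 1) =
      (Ext.mk₀ (π i)).comp (η i) (zero_add 1)) :
    (chainExt K ξ n).comp (Ext.mk₀ (π n)) (add_zero n) =
      (Ext.mk₀ (π 0)).comp (chainExt L η n) (zero_add n) := by
  induction n with
  | zero => simp [chainExt]
  | succ n ih =>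
    have ih := ih fun i hi => h i (Nat.lt_succ_of_lt hi)
    simp only [chainExt]
    rw [Ext.comp_assoc_of_third_deg_zero, h n (Nat.lt_succ_self n),
      ← Ext.comp_assoc_of_second_deg_zero, ih]
    exact Ext.comp_assoc _ _ _ _ _ (by lia)

lemma chainExt_comp_bijective {K : ℕ → C} (ξ : ∀ i, Ext (K i) (K (i + 1)) 1) (Y : C) (d : ℕ)
    (h : ∀ i (a b : ℕ) (hab : 1 + a = b), i + b = d →
      Function.Bijective fun x : Ext (K (i + 1)) Y a => (ξ i).comp x hab) (n : ℕ) :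
    ∀ (a : ℕ) (hna : n + a = d),
      Function.Bijective fun x : Ext (K n) Y a => (chainExt K ξ n).comp x hna := by
  induction n with
  | zero =>
    intro a hna
    obtain rfl : a = d := by lia
    convert Function.bijective_id using 1
    ext x : 1
    simp [chainExt]
  | succ n ih =>
    intro a hna
    convert (ih (1 + a) (by lia)).comp (h n a (1 + a) rfl (by lia)) using 1
    ext x : 1
    exact Ext.comp_assoc _ _ _ _ _ (by lia)

end ChainExt

section QuotientModules

variable {R : Type u} [CommRing R]

lemma indec_quotient {m J : Ideal R} [hm : m.IsMaximal] (hJm : J ≤ m) (hmJ : m ^ 2 ≤ J) :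
    Indec R (R ⧸ J) := by
  have hJ : J ≠ ⊤ := fun h => hm.ne_top (top_le_iff.1 (h ▸ hJm))
  refine ⟨Ideal.Quotient.nontrivial_iff.2 hJ, fun e he => ?_⟩
  obtain ⟨r, hr⟩ := Ideal.Quotient.mk_surjective (e 1)
  have heq (x : R) : e (Ideal.Quotient.mk J x) = Ideal.Quotient.mk J (x * r) := by
    rw [map_mul, hr, ← mul_one (Ideal.Quotient.mk J x)]
    have := e.map_smul x 1
    simpa [Algebra.smul_def] using this
  have hrr : r * r - r ∈ J := by
    rw [← Ideal.Quotient.eq, ← heq, hr, ← Module.End.mul_apply, he]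
  have hprod : r * (r - 1) ∈ m := hJm (by convert hrr using 1; ring)
  rcases hm.isPrime.mem_or_mem hprod with h | h
  · left
    have hrJ : r ∈ J := by
      have := sub_mem (hmJ (Ideal.pow_mem_pow h 2)) hrr
      rwa [pow_two, sub_sub_cancel] at this
    refine LinearMap.ext fun x => ?_
    obtain ⟨x, rfl⟩ := Ideal.Quotient.mk_surjective x
    rw [heq]
    exact Ideal.Quotient.eq_zero_iff_mem.2 (J.mul_mem_left _ hrJ)
  · right
    have hrJ : r - 1 ∈ J := by
      have := sub_mem hrr (hmJ (Ideal.pow_mem_pow h 2))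
      convert this using 1
      ring
    refine LinearMap.ext fun x => ?_
    obtain ⟨x, rfl⟩ := Ideal.Quotient.mk_surjective x
    rw [heq]
    refine Ideal.Quotient.eq.2 ?_
    convert J.mul_mem_left x hrJ using 1
    ring

/-- The complex `R ⧸ I → R ⧸ J → R ⧸ L` given by multiplication by `g` and projection. -/
def quotientComplex (I J L : Ideal R) (g : R) (hI : I ≤ Submodule.comap (LinearMap.mulLeft R g) J)
    (hL : J ≤ L) (hg : g ∈ L) : ShortComplex (ModuleCat.{u} R) :=
  .mk (X₁ := .of R (R ⧸ I)) (X₂ := .of R (R ⧸ J)) (X₃ := .of R (R ⧸ L))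
    (ModuleCat.ofHom (Submodule.mapQ I J (LinearMap.mulLeft R g) hI))
    (ModuleCat.ofHom (Submodule.factor hL)) (by
      refine ModuleCat.hom_ext (LinearMap.ext fun x => ?_)
      obtain ⟨x, rfl⟩ := Ideal.Quotient.mk_surjective x
      exact Ideal.Quotient.eq_zero_iff_mem.2 (L.mul_mem_right _ hg))

variable {I J L : Ideal R} {g : R} {hI : I ≤ Submodule.comap (LinearMap.mulLeft R g) J} {hL : J ≤ L}
  {hg : g ∈ L}

lemma quotientComplex_shortExact (h : ∀ x, g * x ∈ J → x ∈ I) (hLJ : L ≤ Ideal.span {g} ⊔ J) :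
    (quotientComplex I J L g hI hL hg).ShortExact := by
  refine ModuleCat.shortComplex_shortExact _ ?_ ?_ ?_
  · intro y
    obtain ⟨y, rfl⟩ := Ideal.Quotient.mk_surjective y
    constructor
    · intro hy
      have hy : y ∈ L := Ideal.Quotient.eq_zero_iff_mem.1 hy
      obtain ⟨a, z, hz, haz⟩ := Ideal.mem_span_singleton_sup.1 (hLJ hy)
      refine ⟨Ideal.Quotient.mk I a, Ideal.Quotient.eq.2 ?_⟩
      have : g * a - y = - z := by rw [← haz]; ring
      simpa [this] using hz
    · rintro ⟨x, hx⟩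
      obtain ⟨x, rfl⟩ := Ideal.Quotient.mk_surjective x
      rw [← hx]
      exact Ideal.Quotient.eq_zero_iff_mem.2 (L.mul_mem_right _ hg)
  · refine (injective_iff_map_eq_zero (Submodule.mapQ I J (LinearMap.mulLeft R g) hI)).2 ?_
    intro x hx
    obtain ⟨x, rfl⟩ := Ideal.Quotient.mk_surjective x
    exact Ideal.Quotient.eq_zero_iff_mem.2 (h x (Ideal.Quotient.eq_zero_iff_mem.1 hx))
  · exact Submodule.factor_surjective hL

/-- The projections between the complexes of quotients for two triples of ideals. -/
def quotientComplexMap {I' J' L' : Ideal R} {hI' : I' ≤ Submodule.comap (LinearMap.mulLeft R g) J'}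
    {hL' : J' ≤ L'} {hg' : g ∈ L'} (hII' : I ≤ I') (hJJ' : J ≤ J') (hLL' : L ≤ L') :
    quotientComplex I J L g hI hL hg ⟶ quotientComplex I' J' L' g hI' hL' hg' where
  τ₁ := ModuleCat.ofHom (Submodule.factor hII')
  τ₂ := ModuleCat.ofHom (Submodule.factor hJJ')
  τ₃ := ModuleCat.ofHom (Submodule.factor hLL')
  comm₁₂ := by
    refine ModuleCat.hom_ext (LinearMap.ext fun x => ?_)
    obtain ⟨x, rfl⟩ := Ideal.Quotient.mk_surjective x
    rfl
  comm₂₃ := by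
    refine ModuleCat.hom_ext (LinearMap.ext fun x => ?_)
    obtain ⟨x, rfl⟩ := Ideal.Quotient.mk_surjective x
    rfl

open Abelian

variable [HasExt.{u} (ModuleCat.{u} R)]

lemma mk₀_smul_id_comp_eq_zero {X Y : ModuleCat.{u} R} (hY : ∀ y : Y, g • y = 0) {n : ℕ}
    (x : Ext X Y n) : (Ext.mk₀ (g • 𝟙 X)).comp x (zero_add n) = 0 := by
  have hY0 : g • 𝟙 Y = 0 := by
    ext y
    exact hY y
  rw [Ext.mk₀_smul, Ext.smul_comp, Ext.mk₀_id_comp, Ext.smul_eq_comp_mk₀, hY0, Ext.mk₀_zero,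
    Ext.comp_zero]

/-- If `g` kills `Y`, then multiplication by `g` induces zero on `Ext (-, Y)`. -/
lemma quotientComplex_f_comp_eq_zero {hI : J ≤ Submodule.comap (LinearMap.mulLeft R g) J}
    {Y : ModuleCat.{u} R} (hY : ∀ y : Y, g • y = 0) {n : ℕ}
    (x : Ext (quotientComplex J J L g hI hL hg).X₂ Y n) :
    (Ext.mk₀ (quotientComplex J J L g hI hL hg).f).comp x (zero_add n) = 0 := by
  refine Eq.trans ?_ (mk₀_smul_id_comp_eq_zero hY x)
  congr 2

lemma extClass_comp_bijective {S : ShortComplex (ModuleCat.{u} R)} (hS : S.ShortExact)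
    {Y : ModuleCat.{u} R} {a b : ℕ} (hab : 1 + a = b)
    (h0 : ∀ x : Ext S.X₂ Y a, (Ext.mk₀ S.f).comp x (zero_add a) = 0)
    (h1 : ∀ x : Ext S.X₂ Y b, x = 0) :
    Function.Bijective fun x : Ext S.X₁ Y a => hS.extClass.comp x hab := by
  constructor
  · refine (injective_iff_map_eq_zero (hS.extClass.precomp Y hab)).2 fun x hx => ?_
    obtain ⟨y, rfl⟩ := Ext.contravariant_sequence_exact₁ hS Y x hab hx
    exact h0 y
  · exact fun x => Ext.contravariant_sequence_exact₃ hS Y x (h1 _) hab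

lemma ext_X₃_eq_zero {S : ShortComplex (ModuleCat.{u} R)} (hS : S.ShortExact)
    {Y : ModuleCat.{u} R} {a b : ℕ} (hab : 1 + a = b) (h1 : ∀ x : Ext S.X₁ Y a, x = 0)
    (h2 : ∀ x : Ext S.X₂ Y b, x = 0) (x : Ext S.X₃ Y b) : x = 0 := by
  obtain ⟨y, rfl⟩ := Ext.contravariant_sequence_exact₃ hS Y x (h2 _) hab
  rw [h1 y, Ext.comp_zero]

end QuotientModules

section TailComplex

open Abelian

variable {R : Type u} [CommRing R] {f : ℕ → R} {d : ℕ}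

/-- The complex `R ⧸ J' → R ⧸ J' → R ⧸ J` given by multiplication by `f i`, where `J'` and `J`
are generated by the entries of index greater than `i` and at least `i`. -/
abbrev tailComplex (f : ℕ → R) {d i : ℕ} (hi : i < d) : ShortComplex (ModuleCat.{u} R) :=
  quotientComplex (tailIdeal f d (i + 1)) (tailIdeal f d (i + 1)) (tailIdeal f d i) (f i)
    (fun _ hx => Ideal.mul_mem_left _ _ hx) (tailIdeal_anti i.le_succ) (mem_tailIdeal le_rfl hi)

lemma IsTailRegular.tailComplex_shortExact (hf : IsTailRegular f d) {i : ℕ} (hi : i < d) :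
    (tailComplex f hi).ShortExact :=
  quotientComplex_shortExact (hf i hi) (tailIdeal_eq_sup hi).le

/-- The complex `R ⧸ m → R ⧸ J → R ⧸ m` given by multiplication by `f i`, where `m` is generated
by `f 0, …, f (d - 1)` and `J` is `omitIdeal f d i`. -/
abbrev omitComplex (f : ℕ → R) {d i : ℕ} (hi : i < d) : ShortComplex (ModuleCat.{u} R) :=
  quotientComplex (tailIdeal f d 0) (omitIdeal f d i) (tailIdeal f d 0) (f i)
    (fun x hx => Ideal.mem_sup_left (by
      rw [pow_two]
      exact Ideal.mul_mem_mul (mem_tailIdeal i.zero_le hi) hx))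
    omitIdeal_le (mem_tailIdeal i.zero_le hi)

lemma IsTailRegular.omitComplex_shortExact (hf : IsTailRegular f d)
    (hm : (tailIdeal f d 0).IsMaximal) {i : ℕ} (hi : i < d) : (omitComplex f hi).ShortExact := by
  refine quotientComplex_shortExact (fun x hx => ?_) tailIdeal_le_sup_omitIdeal
  by_contra hxm
  obtain ⟨y, z, hz, hyz⟩ := hm.exists_inv hxm
  refine hf.notMem_omitIdeal hm.ne_top hi ?_
  have h1 : y * (f i * x) ∈ omitIdeal f d i := Ideal.mul_mem_left _ _ hx
  have h2 : f i * z ∈ omitIdeal f d i := Ideal.mem_sup_left (by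
    rw [pow_two]
    exact Ideal.mul_mem_mul (mem_tailIdeal i.zero_le hi) hz)
  convert add_mem h1 h2 using 1
  linear_combination (- f i) * hyz

lemma smul_quotient_eq_zero {i : ℕ} (hi : i < d)
    (y : ModuleCat.of R (R ⧸ tailIdeal f d 0)) : f i • y = 0 := by
  obtain ⟨y, rfl⟩ := Ideal.Quotient.mk_surjective y
  exact Ideal.Quotient.eq_zero_iff_mem.2 (Ideal.mul_mem_right _ _ (mem_tailIdeal i.zero_le hi))

variable [HasExt.{u} (ModuleCat.{u} R)]

lemma IsTailRegular.ext_eq_zero (hf : IsTailRegular f d) {i : ℕ} (hi : i ≤ d) :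
    ∀ n, d < i + n → ∀ x : Ext (ModuleCat.of R (R ⧸ tailIdeal f d i))
      (ModuleCat.of R (R ⧸ tailIdeal f d 0)) n, x = 0 := by
  induction hi using Nat.decreasingInduction with
  | self =>
    intro n hn x
    obtain ⟨n, rfl⟩ : ∃ n', n = n' + 1 := ⟨n - 1, by lia⟩
    have : Module.Free R (R ⧸ tailIdeal f d d) :=
      .of_equiv (Submodule.quotEquivOfEqBot _ tailIdeal_self).symm
    exact Ext.eq_zero_of_projective x
  | of_succ i hi ih =>
    intro n hn x
    obtain ⟨n, rfl⟩ : ∃ n', n = 1 + n' := ⟨n - 1, by lia⟩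
    exact ext_X₃_eq_zero (hf.tailComplex_shortExact hi) rfl (ih n (by lia))
      (ih (1 + n) (by lia)) x

lemma IsTailRegular.extClass_comp_bijective (hf : IsTailRegular f d) {i : ℕ} (hi : i < d)
    {a b : ℕ} (hab : 1 + a = b) (hib : i + b = d) :
    Function.Bijective fun x : Ext (ModuleCat.of R (R ⧸ tailIdeal f d (i + 1)))
      (ModuleCat.of R (R ⧸ tailIdeal f d 0)) a =>
        (hf.tailComplex_shortExact hi).extClass.comp x hab :=
  _root_.extClass_comp_bijective (hf.tailComplex_shortExact hi) hab
    (quotientComplex_f_comp_eq_zero (smul_quotient_eq_zero hi))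
    (hf.ext_eq_zero hi b (by lia))

lemma IsTailRegular.extClass_comp_mk₀ (hf : IsTailRegular f d)
    (hm : (tailIdeal f d 0).IsMaximal) {i : ℕ} (hi : i < d) :
    (hf.tailComplex_shortExact hi).extClass.comp
        (Ext.mk₀ (ModuleCat.ofHom (Submodule.factor (tailIdeal_anti (i + 1).zero_le))))
        (add_zero 1) =
      (Ext.mk₀ (ModuleCat.ofHom (Submodule.factor (tailIdeal_anti i.zero_le)))).comp
        (hf.omitComplex_shortExact hm hi).extClass (zero_add 1) :=
  ShortComplex.ShortExact.extClass_naturality (hf.tailComplex_shortExact hi)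
    (hf.omitComplex_shortExact hm hi)
    (quotientComplexMap (tailIdeal_anti (i + 1).zero_le) tailIdeal_succ_le_omitIdeal
      (tailIdeal_anti i.zero_le))

end TailComplex

lemma CategoryTheory.ShortComplex.ShortExact.exists_simple_submodule {R : Type u} [CommRing R]
    {S : ShortComplex (ModuleCat.{u} R)} (hS : S.ShortExact) [IsSimpleModule R S.X₁]
    [IsSimpleModule R S.X₃] :
    ∃ N : Submodule R S.X₂, IsSimpleModule R N ∧ IsSimpleModule R (S.X₂ ⧸ N) := by
  refine ⟨LinearMap.range S.f.hom, ?_, ?_⟩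
  · exact .congr (LinearEquiv.ofInjective S.f.hom hS.moduleCat_injective_f).symm
  · rw [hS.exact.moduleCat_range_eq_ker]
    exact .congr (S.g.hom.quotKerEquivOfSurjective hS.moduleCat_surjective_g)

/-- For `R = k[T₁,…,T_d]` and a maximal ideal `m` with simple module `S = R/m`,
`Ext^d_R(S,S)` is one-dimensional over `End(S)`, generated by the class of an exact sequence
`0 → S → M₁ → ⋯ → M_d → S → 0` whose middle terms are indecomposable `R_m`-modules
(i.e. `m`-power torsion modules) of length two. -/
theorem stmt16 (k : Type u) [Field k] (d : ℕ)
    (m : Ideal (MvPolynomial (Fin d) k)) [m.IsMaximal]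
    [CategoryTheory.HasExt.{u} (ModuleCat.{u} (MvPolynomial (Fin d) k))] :
    ∃ (K : ℕ → ModuleCat.{u} (MvPolynomial (Fin d) k))
      (ξ : ∀ i, Abelian.Ext (K i) (K (i+1)) 1)
      (h0 : K 0 = ModuleCat.of _ (MvPolynomial (Fin d) k ⧸ m))
      (hd : K d = ModuleCat.of _ (MvPolynomial (Fin d) k ⧸ m)),
      (∀ i, i < d →
        ∃ (Sc : ShortComplex (ModuleCat.{u} (MvPolynomial (Fin d) k)))
          (hSc : Sc.ShortExact),
          Sc.X₃ = K i ∧ Sc.X₁ = K (i+1) ∧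
          Indec (MvPolynomial (Fin d) k) ↥Sc.X₂ ∧
          (∃ N₂ : Submodule (MvPolynomial (Fin d) k) ↥Sc.X₂,
            IsSimpleModule (MvPolynomial (Fin d) k) ↥N₂ ∧
            IsSimpleModule (MvPolynomial (Fin d) k) (↥Sc.X₂ ⧸ N₂)) ∧
          (∀ x : ↥Sc.X₂, ∃ j : ℕ, ∀ r ∈ m ^ j, r • x = 0) ∧
          HEq hSc.extClass (ξ i)) ∧
      ∃ ξgen : Abelian.Ext (ModuleCat.of _ (MvPolynomial (Fin d) k ⧸ m))
          (ModuleCat.of _ (MvPolynomial (Fin d) k ⧸ m)) d,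
        ξgen = cast (show Abelian.Ext (K 0) (K d) d = _ by rw [h0, hd]) (chainExt K ξ d) ∧
        ξgen ≠ 0 ∧
        ∀ x : Abelian.Ext (ModuleCat.of _ (MvPolynomial (Fin d) k ⧸ m))
            (ModuleCat.of _ (MvPolynomial (Fin d) k ⧸ m)) d,
          ∃ g, x = (Abelian.Ext.mk₀ g).comp ξgen (zero_add d) := by
  obtain ⟨f, hf, rfl⟩ := maximalIdealsRegular_mvPolynomial k d m inferInstance
  let S := ModuleCat.of (MvPolynomial (Fin d) k) (MvPolynomial (Fin d) k ⧸ tailIdeal f d 0)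
  have hm : (tailIdeal f d 0).IsMaximal := ‹_›
  have hsimple : IsSimpleModule (MvPolynomial (Fin d) k) (MvPolynomial (Fin d) k ⧸ tailIdeal f d 0) :=
    isSimpleModule_iff_isCoatom.2 (Ideal.isMaximal_def.1 hm)
  let A (i : ℕ) : ModuleCat.{u} (MvPolynomial (Fin d) k) := .of _ (MvPolynomial (Fin d) k ⧸ tailIdeal f d i)
  let π (i : ℕ) : A i ⟶ S := ModuleCat.ofHom (Submodule.factor (tailIdeal_anti i.zero_le))
  let δ (i : ℕ) : Abelian.Ext (A i) (A (i + 1)) 1 :=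
    if hi : i < d then (hf.tailComplex_shortExact hi).extClass else 0
  let ξ (i : ℕ) : Abelian.Ext S S 1 :=
    if hi : i < d then (hf.omitComplex_shortExact hm hi).extClass else 0
  have hδ (i : ℕ) (hi : i < d) : δ i = (hf.tailComplex_shortExact hi).extClass := dif_pos hi
  have hξ (i : ℕ) (hi : i < d) : ξ i = (hf.omitComplex_shortExact hm hi).extClass := dif_pos hi
  have hδξ : (chainExt A δ d).comp (Abelian.Ext.mk₀ (π d)) (add_zero d) =
      chainExt (fun _ => S) ξ d := by
    rw [chainExt_comp_mk₀ (L := fun _ => S) δ ξ π d fun i hi => ?_]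
    · have hπ : π 0 = 𝟙 S := by
        refine ModuleCat.hom_ext (LinearMap.ext fun x => ?_)
        obtain ⟨x, rfl⟩ := Ideal.Quotient.mk_surjective x
        rfl
      rw [hπ]
      exact Abelian.Ext.mk₀_id_comp _
    · rw [hδ i hi, hξ i hi]
      exact hf.extClass_comp_mk₀ hm hi
  have hbij := chainExt_comp_bijective δ S d (fun i a b hab hib => by
    have hi : i < d := by lia
    rw [hδ i hi]
    exact hf.extClass_comp_bijective hi hab hib) d 0 (add_zero d)
  refine ⟨fun _ => S, ξ, rfl, rfl, fun i hi => ?_, chainExt (fun _ => S) ξ d, rfl, ?_, ?_⟩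
  · have hSc := hf.omitComplex_shortExact hm hi
    have : IsSimpleModule (MvPolynomial (Fin d) k) (omitComplex f hi).X₁ := hsimple
    have : IsSimpleModule (MvPolynomial (Fin d) k) (omitComplex f hi).X₃ := hsimple
    refine ⟨omitComplex f hi, hSc, rfl, rfl, indec_quotient omitIdeal_le le_sup_left,
      hSc.exists_simple_submodule, fun x => ⟨2, fun r hr => ?_⟩, ?_⟩
    · obtain ⟨x, rfl⟩ := Ideal.Quotient.mk_surjective x
      exact Ideal.Quotient.eq_zero_iff_mem.2 (Ideal.mul_mem_right _ _ (Ideal.mem_sup_left hr))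
    · exact heq_of_eq (hξ i hi).symm
  · intro h0
    have hπ : Abelian.Ext.mk₀ (π d) = 0 :=
      hbij.injective (hδξ.trans (h0.trans (Abelian.Ext.comp_zero ..).symm))
    rw [Abelian.Ext.mk₀_eq_zero_iff] at hπ
    refine hm.ne_top ((Ideal.eq_top_iff_one _).2 (Ideal.Quotient.eq_zero_iff_mem.1 ?_))
    exact congrArg (fun φ : A d ⟶ S => φ.hom (Ideal.Quotient.mk (tailIdeal f d d) 1)) hπ
  · intro x
    obtain ⟨y, rfl⟩ := hbij.surjective x
    obtain ⟨φ, rfl⟩ := Abelian.Ext.mk₀_bijective _ _ |>.surjective y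
    obtain ⟨r, hr⟩ := Ideal.Quotient.mk_surjective (φ.hom (Ideal.Quotient.mk _ 1))
    have hφ : φ = r • π d := by
      refine ModuleCat.hom_ext (LinearMap.ext fun z => ?_)
      obtain ⟨z, rfl⟩ := Ideal.Quotient.mk_surjective z
      have h1 : Ideal.Quotient.mk (tailIdeal f d d) z =
          z • Ideal.Quotient.mk (tailIdeal f d d) 1 := by
        rw [Algebra.smul_def, map_one, mul_one]
        rfl
      rw [h1, map_smul, map_smul, ← hr]
      congr 1
      exact congrArg (Ideal.Quotient.mk (tailIdeal f d 0)) (mul_one r).symm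
    refine ⟨r • 𝟙 S, ?_⟩
    rw [Abelian.Ext.mk₀_smul, Abelian.Ext.smul_comp, Abelian.Ext.mk₀_id_comp, ← hδξ, hφ,
      Abelian.Ext.mk₀_smul]
    exact Abelian.Ext.comp_smul ..
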